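/- (Limit of a(t) in the negative slope motif with equal outflows via L'Hospital.) Let k₁, k₂ > 0, k* = k₂/k₁, and ℓ > 0. Let g_a, g_b : ℝ_{≥0} → ℝ_{≥0} with g(t) := g_a(t) + g_b(t) → ∞ as t → ∞, g_a differentiable and g_a ≢ 0. Let a, b : [0,∞) → ℝ_{≥0} be differentiable satisfying ȧ(t) = k₁·b(t)·(k* − a(t)) + g_a(t) − ℓ·a(t) and ḃ(t) = −k₁·b(t)·(k* − a(t)) + g_b(t) − ℓ·b(t), with b(0) > 0 if g_b ≡ 0. If the limit L := lim_{t→∞} [ ℓ·g_a(t)/g(t) + g_a'(t)/g(t) ] exists and is finite, then lim_{t→∞} g_a(t)/H(t) = L where H(t) = e^{−ℓt} ∫₀ᵗ g(s) e^{ℓs} ds, and consequently a(t) → k* + L/k₁ as t → ∞. -/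

import Mathlib

open Filter MeasureTheory Topology

lemma aux_stay {f f' : ℝ → ℝ} {T c : ℝ} (hf : ∀ t ≥ T, HasDerivAt f (f' t) t)
    (h0 : f T ≤ c) (hc : ∀ t ≥ T, f t = c → f' t < 0) : ∀ t ≥ T, f t ≤ c := by
  intro t ht
  refine image_le_of_deriv_right_lt_deriv_boundary' (f := f) (f' := f') (a := T) (b := t)
    (B := fun _ => c) (B' := fun _ => 0) ?_ ?_ h0 continuousOn_const ?_ ?_ ⟨ht, le_rfl⟩
  · intro x hx
    exact (hf x hx.1).continuousAt.continuousWithinAt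
  · intro x hx
    exact (hf x hx.1).hasDerivWithinAt
  · intro x hx
    exact hasDerivWithinAt_const _ _ _
  · intro x hx h
    exact hc x hx.1 h

lemma aux_anti {f f' : ℝ → ℝ} {T : ℝ} (hf : ∀ t ≥ T, HasDerivAt f (f' t) t)
    (hc : ∀ t ≥ T, f' t ≤ 0) : ∀ s ≥ T, ∀ t ≥ s, f t ≤ f s := by
  intro s hs t ht
  have : AntitoneOn f (Set.Ici T) := by
    refine antitoneOn_of_hasDerivWithinAt_nonpos (f' := f') (convex_Ici T) ?_ ?_ ?_
    · intro x hx
      exact (hf x hx).continuousAt.continuousWithinAt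
    · intro x hx
      rw [interior_Ici] at hx
      exact (hf x (le_of_lt hx)).hasDerivWithinAt
    · intro x hx
      rw [interior_Ici] at hx
      exact hc x (le_of_lt hx)
  exact this hs (le_trans hs ht) ht

lemma aux_barrier {f f' : ℝ → ℝ} {T c κ : ℝ} (hκ : 0 < κ)
    (hf : ∀ t ≥ T, HasDerivAt f (f' t) t)
    (hc : ∀ t ≥ T, c ≤ f t → f' t ≤ -κ) : ∀ᶠ t in atTop, f t ≤ c := by
  have h1 : ∃ s ≥ T, f s ≤ c := by
    by_contra! hcon
    have h2 := aux_anti (f := fun t => f t + κ * t) (f' := fun t => f' t + κ * 1) (T := T)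
      (fun t ht => (hf t ht).add ((hasDerivAt_id t).const_mul κ))
      (fun t ht => by
        have := hc t ht (hcon t ht).le
        linarith) T le_rfl
    have h3 : T ≤ T + (f T - c) / κ := by
      have := hcon T le_rfl
      have : 0 ≤ (f T - c) / κ := div_nonneg (by linarith) hκ.le
      linarith
    have h4 := h2 _ h3
    have h5 := hcon _ h3
    have h6 : κ * (T + (f T - c) / κ) = κ * T + (f T - c) := by field_simp
    simp only [h6] at h4
    linarith
  obtain ⟨s, hs, hfs⟩ := h1
  filter_upwards [eventually_ge_atTop s] with t ht
  exact aux_stay (fun t ht => hf t (hs.le.trans ht)) hfs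
    (fun t ht h => lt_of_le_of_lt (hc t (hs.le.trans ht) h.ge) (by linarith)) t ht

lemma aux_lh_up {F F' G G' : ℝ → ℝ} {L c : ℝ} (hF : ∀ t ≥ (0:ℝ), HasDerivAt F (F' t) t)
    (hG : ∀ t ≥ (0:ℝ), HasDerivAt G (G' t) t) (hG' : ∀ᶠ t in atTop, 0 < G' t)
    (hGt : Tendsto G atTop atTop) (hL : Tendsto (fun t => F' t / G' t) atTop (𝓝 L))
    (hc : L < c) : ∀ᶠ t in atTop, F t / G t < c := by
  obtain ⟨d, hd1, hd2⟩ := exists_between hc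
  obtain ⟨T, hT⟩ := eventually_atTop.1
    ((hG'.and (hL.eventually_lt_const hd1)).and (eventually_ge_atTop (0:ℝ)))
  have h2 := aux_anti (f := fun t => F t - d * G t) (f' := fun t => F' t - d * G' t) (T := T)
      (fun t ht => (hF t (hT t ht).2).sub ((hG t (hT t ht).2).const_mul d))
      (fun t ht => by
        have := (hT t ht).1.2
        rw [div_lt_iff₀ (hT t ht).1.1] at this
        linarith) T le_rfl
  filter_upwards [eventually_ge_atTop T, hGt.eventually_gt_atTop 0,
    hGt.eventually_gt_atTop ((F T - d * G T) / (c - d))] with t ht h0 h3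
  rw [div_lt_iff₀ h0]
  rw [div_lt_iff₀ (by linarith)] at h3
  have := h2 t ht
  linarith

lemma aux_lh {F F' G G' : ℝ → ℝ} {L : ℝ} (hF : ∀ t ≥ (0:ℝ), HasDerivAt F (F' t) t)
    (hG : ∀ t ≥ (0:ℝ), HasDerivAt G (G' t) t) (hG' : ∀ᶠ t in atTop, 0 < G' t)
    (hGt : Tendsto G atTop atTop) (hL : Tendsto (fun t => F' t / G' t) atTop (𝓝 L)) :
    Tendsto (fun t => F t / G t) atTop (𝓝 L) := by
  rw [tendsto_order]
  constructor
  · intro c hc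
    have := aux_lh_up (F := fun t => - F t) (F' := fun t => - F' t) (L := -L) (c := -c)
      (fun t ht => (hF t ht).neg) hG hG' hGt (by simpa [neg_div] using hL.neg) (by linarith)
    filter_upwards [this] with t ht
    rw [neg_div] at ht
    linarith
  · intro c hc
    exact aux_lh_up hF hG hG' hGt hL hc


/-- Limit via L'Hospital in the negative slope motif with equal
outflows: under the setting of the equal-outflow theorem, with `g_a` differentiable
and `g_a ≢ 0`, if `L = lim_{t→∞} [ℓ·g_a(t)/g(t) + g_a'(t)/g(t)]` exists and is finite,
then `g_a(t)/H(t) → L` and consequently `a(t) → k* + L/k₁`. -/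
theorem stmt12 (k₁ k₂ ks ℓ : ℝ) (hk₁ : 0 < k₁) (hk₂ : 0 < k₂) (hks : ks = k₂ / k₁)
    (hℓ : 0 < ℓ)
    (ga gb ga' : ℝ → ℝ)
    (hga0 : ∀ t ≥ (0:ℝ), 0 ≤ ga t) (hgb0 : ∀ t ≥ (0:ℝ), 0 ≤ gb t)
    (hgadiff : ∀ t ≥ (0:ℝ), HasDerivAt ga (ga' t) t)
    (hgane : ¬ (∀ t ≥ (0:ℝ), ga t = 0))
    (hgtop : Tendsto (fun t => ga t + gb t) atTop atTop)
    (a b : ℝ → ℝ)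
    (hanneg : ∀ t ≥ (0:ℝ), 0 ≤ a t) (hbnneg : ∀ t ≥ (0:ℝ), 0 ≤ b t)
    (ha : ∀ t ≥ (0:ℝ), HasDerivAt a (k₁ * b t * (ks - a t) + ga t - ℓ * a t) t)
    (hb : ∀ t ≥ (0:ℝ), HasDerivAt b (-(k₁ * b t * (ks - a t)) + gb t - ℓ * b t) t)
    (hb0 : (∀ t ≥ (0:ℝ), gb t = 0) → 0 < b 0)
    (H : ℝ → ℝ)
    (hH : ∀ t, H t = Real.exp (-ℓ * t) * ∫ s in (0:ℝ)..t, (ga s + gb s) * Real.exp (ℓ * s))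
    (L : ℝ)
    (hL : Tendsto (fun t => ℓ * ga t / (ga t + gb t) + ga' t / (ga t + gb t))
      atTop (𝓝 L)) :
    Tendsto (fun t => ga t / H t) atTop (𝓝 L) ∧
    Tendsto a atTop (𝓝 (ks + L / k₁)) := by
  have hS : ∀ t ≥ (0:ℝ), HasDerivAt (fun t => a t + b t) (ga t + gb t - ℓ * (a t + b t)) t := by
    intro t ht
    refine HasDerivAt.congr_deriv ((ha t ht).add (hb t ht)) ?_
    ring
  have hSt : Tendsto (fun t => a t + b t) atTop atTop := by
    rw [tendsto_atTop]
    intro M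
    obtain ⟨T, hT⟩ := eventually_atTop.1
      ((hgtop.eventually_ge_atTop (ℓ * M + 1)).and (eventually_ge_atTop (0:ℝ)))
    have := aux_barrier (f := fun t => -(a t + b t)) (c := -M) (κ := 1) (T := T) one_pos
      (fun t ht => (hS t (hT t ht).2).neg) (fun t ht h => by
        have h1 := (hT t ht).1
        have : ℓ * (a t + b t) ≤ ℓ * M := mul_le_mul_of_nonneg_left (by linarith) hℓ.le
        linarith)
    filter_upwards [this] with t ht
    linarith
  have hE : ∀ t, HasDerivAt (fun t => Real.exp (ℓ * t)) (ℓ * Real.exp (ℓ * t)) t := by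
    intro t
    refine HasDerivAt.congr_deriv (((hasDerivAt_id t).const_mul ℓ).exp) ?_
    simp [mul_comm]
  have hG1 : ∀ t ≥ (0:ℝ), HasDerivAt (fun t => (a t + b t) * Real.exp (ℓ * t))
      ((ga t + gb t) * Real.exp (ℓ * t)) t := by
    intro t ht
    refine HasDerivAt.congr_deriv ((hS t ht).mul (hE t)) ?_
    ring
  have hG1t : Tendsto (fun t => (a t + b t) * Real.exp (ℓ * t)) atTop atTop := by
    refine tendsto_atTop_mono' _ ?_ hSt
    filter_upwards [eventually_ge_atTop (0:ℝ)] with t ht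
    have : 1 ≤ Real.exp (ℓ * t) := Real.one_le_exp (by positivity)
    exact le_mul_of_one_le_right (add_nonneg (hanneg t ht) (hbnneg t ht)) this
  have hint : ∀ t ≥ (0:ℝ), ∫ s in (0:ℝ)..t, (ga s + gb s) * Real.exp (ℓ * s)
      = (a t + b t) * Real.exp (ℓ * t) - (a 0 + b 0) := by
    intro t ht
    have hmem : ∀ x ∈ Set.uIcc 0 t, (0:ℝ) ≤ x := by
      intro x hx
      rw [Set.uIcc_of_le ht] at hx
      exact hx.1
    rw [intervalIntegral.integral_eq_sub_of_hasDerivAt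
      (f := fun t => (a t + b t) * Real.exp (ℓ * t)) (fun x hx => hG1 x (hmem x hx))]
    · simp
    · refine intervalIntegral.intervalIntegrable_deriv_of_nonneg
        (g := fun t => (a t + b t) * Real.exp (ℓ * t)) ?_ ?_ ?_
      · intro x hx
        exact (hG1 x (hmem x hx)).continuousAt.continuousWithinAt
      · intro x hx
        rw [min_eq_left ht] at hx
        exact hG1 x hx.1.le
      · intro x hx
        rw [min_eq_left ht] at hx
        exact mul_nonneg (add_nonneg (hga0 x hx.1.le) (hgb0 x hx.1.le)) (Real.exp_pos _).le
  have hF : ∀ t ≥ (0:ℝ), HasDerivAt (fun t => ga t * Real.exp (ℓ * t))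
      ((ℓ * ga t + ga' t) * Real.exp (ℓ * t)) t := by
    intro t ht
    refine HasDerivAt.congr_deriv ((hgadiff t ht).mul (hE t)) ?_
    ring
  have hgpos : ∀ᶠ t in atTop, 0 < (ga t + gb t) * Real.exp (ℓ * t) := by
    filter_upwards [hgtop.eventually_gt_atTop 0] with t ht
    positivity
  have hratio : Tendsto (fun t => ((ℓ * ga t + ga' t) * Real.exp (ℓ * t)) /
      ((ga t + gb t) * Real.exp (ℓ * t))) atTop (𝓝 L) := by
    refine hL.congr (fun t => ?_)
    rw [mul_div_mul_right _ _ (Real.exp_pos _).ne', add_div]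
  have hlim1 : Tendsto (fun t => ga t / (a t + b t)) atTop (𝓝 L) := by
    refine (aux_lh hF hG1 hgpos hG1t hratio).congr (fun t => ?_)
    rw [mul_div_mul_right _ _ (Real.exp_pos _).ne']
  have hlim2 : Tendsto (fun t => ga t / H t) atTop (𝓝 L) := by
    have hG2 : ∀ t ≥ (0:ℝ), HasDerivAt (fun t => (a t + b t) * Real.exp (ℓ * t) - (a 0 + b 0))
      ((ga t + gb t) * Real.exp (ℓ * t)) t := fun t ht => (hG1 t ht).sub_const _
    have hG2t : Tendsto (fun t => (a t + b t) * Real.exp (ℓ * t) - (a 0 + b 0)) atTop atTop :=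
      tendsto_atTop_add_const_right _ _ hG1t
    refine (aux_lh hF hG2 hgpos hG2t hratio).congr' ?_
    filter_upwards [eventually_ge_atTop (0:ℝ)] with t ht
    rw [hH, hint t ht, neg_mul, Real.exp_neg]
    have := (Real.exp_pos (ℓ * t)).ne'
    rw [inv_mul_eq_div, div_div_eq_mul_div]
  refine ⟨hlim2, ?_⟩
  have hL0 : 0 ≤ L := by
    refine ge_of_tendsto hlim1 ?_
    filter_upwards [eventually_ge_atTop (0:ℝ)] with t ht
    exact div_nonneg (hga0 t ht) (add_nonneg (hanneg t ht) (hbnneg t ht))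
  have hks0 : 0 < ks := by rw [hks]; positivity
  -- b positive somewhere
  have hbpos0 : ∃ t₀ ≥ (0:ℝ), 0 < b t₀ := by
    by_contra! hcon
    have hz : ∀ t ≥ (0:ℝ), b t = 0 := fun t ht => le_antisymm (hcon t ht) (hbnneg t ht)
    have hgbz : ∀ t ≥ (0:ℝ), gb t = 0 := by
      intro t ht
      have h1 := (hb t ht).hasDerivWithinAt (s := Set.Ici t)
      have h2 : HasDerivWithinAt b 0 (Set.Ici t) t :=
        (hasDerivWithinAt_const t (Set.Ici t) (0:ℝ)).congr
          (fun x hx => hz x (ht.le.trans hx)) (hz t ht)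
      have h3 := (uniqueDiffWithinAt_Ici t).eq_deriv _ h1 h2
      rw [hz t ht] at h3
      linarith
    have := hb0 hgbz
    linarith [hz 0 le_rfl]
  obtain ⟨t₀, ht₀, hbt₀⟩ := hbpos0
  have hbpos : ∀ t ≥ t₀, 0 < b t := by
    intro t ht
    let c := k₁ * ks + ℓ
    have hEc : ∀ t, HasDerivAt (fun t => Real.exp (c * t)) (c * Real.exp (c * t)) t := by
      intro t
      refine HasDerivAt.congr_deriv (((hasDerivAt_id t).const_mul c).exp) ?_
      simp [mul_comm]
    have := aux_anti (T := 0) (f := fun t => -(b t * Real.exp (c * t)))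
      (fun t ht => ((hb t ht).mul (hEc t)).neg) (fun t ht => by
        have h1 : 0 ≤ (k₁ * b t * a t + gb t) * Real.exp (c * t) := by
          have := hanneg t ht
          have := hbnneg t ht
          have := hgb0 t ht
          positivity
        have h2 : (k₁ * b t * a t + gb t) * Real.exp (c * t) =
          (-(k₁ * b t * (ks - a t)) + gb t - ℓ * b t) * Real.exp (c * t) +
            b t * (c * Real.exp (c * t)) := by
          simp only [c]; ring
        linarith) t₀ ht₀ t ht
    have h3 : 0 < b t₀ * Real.exp (c * t₀) := by positivity
    have h4 : 0 < b t * Real.exp (c * t) := by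
      linarith
    exact pos_of_mul_pos_left h4 (Real.exp_pos _).le
  have hbt : Tendsto b atTop atTop := by
    rw [tendsto_atTop]
    intro M
    obtain ⟨T, hT⟩ := eventually_atTop.1
      ((hSt.eventually_ge_atTop (M + ks + (ℓ + 1) / k₁)).and (eventually_ge_atTop t₀))
    have key : ∀ t ≥ T, b t ≤ M → b t ≤ -(k₁ * b t * (ks - a t)) + gb t - ℓ * b t := by
      intro t ht hM
      have h1 := (hT t ht).1
      have h2 := (hT t ht).2
      have h3 : (ℓ + 1) / k₁ ≤ a t - ks := by linarith
      rw [div_le_iff₀ hk₁] at h3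
      have h4 := mul_le_mul_of_nonneg_left h3 (hbpos t h2).le
      have h5 := hgb0 t (ht₀.le.trans h2)
      nlinarith
    have hTt := (hT T le_rfl).2
    have hβ : 0 < b T := hbpos T hTt
    by_cases hMT : M ≤ b T
    · have := aux_stay (T := T) (c := -M) (f := fun t => - b t)
        (fun t ht => (hb t (ht₀.le.trans (hT t ht).2)).neg) (by linarith) (fun t ht h => by
          have h1 : b t = M := by linarith
          have := key t ht h1.le
          have := hbpos t (hT t ht).2
          linarith)
      filter_upwards [eventually_ge_atTop T] with t ht
      linarith [this t ht]
    · have h0 := aux_stay (T := T) (c := -b T) (f := fun t => - b t)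
        (fun t ht => (hb t (ht₀.le.trans (hT t ht).2)).neg) (by linarith) (fun t ht h => by
          have := key t ht (by linarith)
          have := hbpos t (hT t ht).2
          linarith)
      have := aux_barrier (T := T) (c := -M) (κ := b T) (f := fun t => - b t) hβ
        (fun t ht => (hb t (ht₀.le.trans (hT t ht).2)).neg) (fun t ht h => by
          have := key t ht (by linarith)
          have := h0 t ht
          linarith)
      filter_upwards [this] with t ht
      linarith
  have hm : k₁ * (ks + L / k₁) = k₁ * ks + L := by field_simp
  set m := ks + L / k₁ with hmdef
  have hm0 : 0 < m := by
    have : 0 ≤ L / k₁ := div_nonneg hL0 hk₁.le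
    linarith
  have hup : ∀ δ > 0, ∀ᶠ t in atTop, a t ≤ m + δ := by
    intro δ hδ
    let ε := k₁ * δ / 4
    have hε : 0 < ε := by positivity
    let η := k₁ * δ / (4 * (m + δ))
    have hη : 0 < η := by positivity
    have hηm : η * (m + δ) = k₁ * δ / 4 := by simp only [η]; field_simp
    have hηk : η ≤ k₁ := by
      simp only [η]
      rw [div_le_iff₀ (by positivity)]
      nlinarith
    obtain ⟨T, hT⟩ := eventually_atTop.1
      ((((hSt.eventually_gt_atTop 0).and (hlim1.eventually_lt_const (show L < L + ε by linarith))).and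
        ((hbt.eventually_ge_atTop ((L + ε) / η)).and (hbt.eventually_ge_atTop 1))).and
          (eventually_ge_atTop (0:ℝ)))
    refine aux_barrier (T := T) (κ := k₁ * δ / 2) (by positivity)
      (fun t ht => ha t (hT t ht).2) (fun t ht h => ?_)
    obtain ⟨⟨⟨h1, h2⟩, h3, h4⟩, h5⟩ := hT t ht
    rw [div_lt_iff₀ h1] at h2
    rw [div_le_iff₀ hη] at h3
    have h6 : (L + ε) * a t ≤ b t * η * a t := mul_le_mul_of_nonneg_right h3 (hanneg t h5)
    have h7 : 0 ≤ ℓ * a t := mul_nonneg hℓ.le (hanneg t h5)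
    have h8 : (k₁ - η) * (m + δ) ≤ (k₁ - η) * a t :=
      mul_le_mul_of_nonneg_left h (by linarith)
    have h9 : k₁ * δ / 2 ≤ (k₁ - η) * a t - (k₁ * ks + L + ε) := by
      have : ε = k₁ * δ / 4 := rfl
      nlinarith
    have h10 : b t * (k₁ * δ / 2) ≤ b t * ((k₁ - η) * a t - (k₁ * ks + L + ε)) :=
      mul_le_mul_of_nonneg_left h9 (by linarith)
    have h11 : k₁ * δ / 2 ≤ b t * (k₁ * δ / 2) := le_mul_of_one_le_left (by positivity) h4
    linarith
  have hlo : ∀ δ > 0, ∀ᶠ t in atTop, m - δ ≤ a t := by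
    intro δ hδ
    let ε := k₁ * δ / 2
    have hε : 0 < ε := by positivity
    obtain ⟨T, hT⟩ := eventually_atTop.1
      ((((hSt.eventually_gt_atTop 0).and (hlim1.eventually_const_lt (show L - ε < L by linarith))).and
        ((hbt.eventually_ge_atTop (((ε + ℓ) * m + 1) / ε)))).and
          (eventually_ge_atTop (0:ℝ)))
    have := aux_barrier (T := T) (κ := 1) (c := -(m - δ)) (f := fun t => - a t) one_pos
      (fun t ht => (ha t (hT t ht).2).neg) (fun t ht h => by
        obtain ⟨⟨⟨h1, h2⟩, h3⟩, h5⟩ := hT t ht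
        rw [lt_div_iff₀ h1] at h2
        rw [div_le_iff₀ hε] at h3
        have h4 := hanneg t h5
        have hB := hbnneg t h5
        have h6 : (ε + ℓ) * a t ≤ (ε + ℓ) * m :=
          mul_le_mul_of_nonneg_left (by linarith) (by positivity)
        have h7 : 0 ≤ L * a t := mul_nonneg hL0 h4
        have h8 : k₁ * a t ≤ k₁ * (m - δ) := mul_le_mul_of_nonneg_left (by linarith) hk₁.le
        have h9 : ε ≤ k₁ * ks + L - ε - k₁ * a t := by
          have : ε = k₁ * δ / 2 := rfl
          linarith
        have h10 := mul_le_mul_of_nonneg_left h9 hB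
        linarith)
    filter_upwards [this] with t ht
    linarith
  rw [tendsto_order]
  constructor
  · intro c hc
    filter_upwards [hlo ((m - c) / 2) (by linarith)] with t ht
    linarith
  · intro c hc
    filter_upwards [hup ((c - m) / 2) (by linarith)] with t ht
    linarith
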